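/- arXiv:1707.02503 — 2 statements merged into one kernel-verified Lean document; each statement's English description precedes it below -/
import Mathlib

section
/- Let T ≥ 1 and N ≥ 1 be integers, b ∈ ℝ^T, and for each n ∈ {1,…,N} let C_n ⊆ ℝ^T be a nonempty convex set such that all elements of C_n have the same coordinate sum (there is P_n ∈ ℝ with Σ_{t=1}^T p(t) = P_n for every p ∈ C_n). Let p_n ∈ C_n, set d = (1/N)·(b + Σ_{n=1}^N p_n), and for each n let p_n⁺ ∈ C_n be a minimizer of ‖p − p_n + d‖² over p ∈ C_n. Define d⁺ = (1/N)·(b + Σ_{n=1}^N p_n⁺). Then T·N²·(V(d) − V(d⁺)) ≥ N·Σ_{n=1}^N ‖p_n⁺ − p_n‖²; in particular V(d⁺) ≤ V(d). -/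
open scoped RealInnerProductSpace

/-- The (time) variance of a traffic profile `d ∈ ℝ^T`. -/
noncomputable def V {T : ℕ} (d : EuclideanSpace ℝ (Fin T)) : ℝ :=
  (1 / (T : ℝ)) * ∑ t, (d t - (1 / (T : ℝ)) * ∑ s, d s) ^ 2

lemma V_aux {T : ℕ} (hT : 1 ≤ T) (d : EuclideanSpace ℝ (Fin T)) :
    (T : ℝ) * V d = ‖d‖ ^ 2 - (∑ s, d s) ^ 2 / T := by
  have hT' : (T : ℝ) ≠ 0 := by positivity
  rw [EuclideanSpace.real_norm_sq_eq]
  unfold V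
  generalize hm : ∑ s, d s = m
  have : ∑ t, (d t - (1 / (T : ℝ)) * m) ^ 2 = ∑ t, d t ^ 2 - m ^ 2 / T := by
    have h : ∀ t, (d t - (1 / (T : ℝ)) * m) ^ 2
        = d t ^ 2 - (2 / (T : ℝ) * m) * d t + (m / T) ^ 2 := by
      intro t; ring
    simp only [h, Finset.sum_add_distrib, Finset.sum_sub_distrib, ← Finset.mul_sum, hm]
    simp
    field_simp
    ring
  rw [this]
  field_simp

lemma opt_aux {E : Type*} [NormedAddCommGroup E] [InnerProductSpace ℝ E] {C : Set E}
    (hC : Convex ℝ C) {p q d : E} (hp : p ∈ C) (hq : q ∈ C)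
    (hmin : ∀ r ∈ C, ‖q - p + d‖ ≤ ‖r - p + d‖) :
    ‖q - p‖ ^ 2 ≤ - inner ℝ d (q - p) := by
  by_contra! hlt
  set a : ℝ := ‖q - p‖ ^ 2 + inner ℝ d (q - p) with ha
  have ha0 : 0 < a := by linarith
  set s : ℝ := ‖q - p‖ ^ 2 with hs
  have hs0 : 0 ≤ s := by positivity
  have key : ∀ t : ℝ, 0 ≤ t → t ≤ 1 → 0 ≤ -2 * t * a + t ^ 2 * s := by
    intro t h0 h1
    have hm := hmin ((1 - t) • q + t • p) (hC hq hp (by linarith) h0 (by ring))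
    have e : (1 - t) • q + t • p - p + d = (q - p + d) - t • (q - p) := by module
    rw [e] at hm
    have h2 : ‖q - p + d‖ ^ 2 ≤ ‖(q - p + d) - t • (q - p)‖ ^ 2 := by gcongr
    rw [norm_sub_sq_real (q - p + d), inner_smul_right, inner_add_left,
      real_inner_self_eq_norm_sq, norm_smul, mul_pow, Real.norm_eq_abs, sq_abs] at h2
    rw [ha]
    linarith
  have hpos : 0 < a + s := by linarith
  have h := key (a / (a + s)) (by positivity) (by rw [div_le_one hpos]; linarith)
  have e : -2 * (a / (a + s)) * a + (a / (a + s)) ^ 2 * s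
      = -(a ^ 2 * (2 * a + s)) / (a + s) ^ 2 := by
    field_simp
    ring
  rw [e] at h
  have : 0 < (a ^ 2 * (2 * a + s)) / (a + s) ^ 2 := by positivity
  rw [neg_div] at h
  linarith

theorem one_step_descent_continuous (T N : ℕ) (hT : 1 ≤ T) (hN : 1 ≤ N)
    (b : EuclideanSpace ℝ (Fin T))
    (C : Fin N → Set (EuclideanSpace ℝ (Fin T)))
    (hconv : ∀ n, Convex ℝ (C n)) (hne : ∀ n, (C n).Nonempty)
    (hsum : ∀ n, ∃ P : ℝ, ∀ p ∈ C n, ∑ t, p t = P)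
    (p : Fin N → EuclideanSpace ℝ (Fin T)) (hp : ∀ n, p n ∈ C n)
    (d : EuclideanSpace ℝ (Fin T)) (hd : d = (1 / (N : ℝ)) • (b + ∑ n, p n))
    (pplus : Fin N → EuclideanSpace ℝ (Fin T)) (hpplus : ∀ n, pplus n ∈ C n)
    (hmin : ∀ n, ∀ q ∈ C n, ‖pplus n - p n + d‖ ≤ ‖q - p n + d‖)
    (d' : EuclideanSpace ℝ (Fin T)) (hd' : d' = (1 / (N : ℝ)) • (b + ∑ n, pplus n)) :
    (N : ℝ) * ∑ n, ‖pplus n - p n‖ ^ 2 ≤ (T : ℝ) * (N : ℝ) ^ 2 * (V d - V d')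
      ∧ V d' ≤ V d := by
  have hN' : (0 : ℝ) < N := by positivity
  have hT' : (0 : ℝ) < T := by positivity
  have hopt : ∀ n, ‖pplus n - p n‖ ^ 2 ≤ - inner ℝ d (pplus n - p n) := fun n =>
    opt_aux (hconv n) (hp n) (hpplus n) (hmin n)
  have hdd : d' = d + (1 / (N : ℝ)) • ∑ n, (pplus n - p n) := by
    rw [hd, hd', Finset.sum_sub_distrib]; module
  have hS : ∑ t, d' t = ∑ t, d t := by
    have h0 : ∑ t, (∑ n, (pplus n - p n)) t = 0 := by
      simp only [WithLp.ofLp_sum, Finset.sum_apply]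
      rw [Finset.sum_comm]
      refine Finset.sum_eq_zero fun n _ => ?_
      obtain ⟨P, hP⟩ := hsum n
      simp [Finset.sum_sub_distrib, hP _ (hp n), hP _ (hpplus n)]
    rw [hdd]
    simp only [PiLp.add_apply, PiLp.smul_apply, smul_eq_mul, Finset.sum_add_distrib,
      ← Finset.mul_sum, h0]
    ring
  have hsumopt : ∑ n, ‖pplus n - p n‖ ^ 2 ≤ - inner ℝ d (∑ n, (pplus n - p n)) := by
    rw [inner_sum, ← Finset.sum_neg_distrib]
    exact Finset.sum_le_sum fun n _ => hopt n
  have hcs : ‖∑ n, (pplus n - p n)‖ ^ 2 ≤ N * ∑ n, ‖pplus n - p n‖ ^ 2 := by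
    have h1 : ‖∑ n, (pplus n - p n)‖ ^ 2 ≤ (∑ n, ‖pplus n - p n‖) ^ 2 := by
      gcongr; exact norm_sum_le _ _
    have h2 := sq_sum_le_card_mul_sum_sq (s := Finset.univ) (f := fun n => ‖pplus n - p n‖)
    simp only [Finset.card_univ, Fintype.card_fin] at h2
    exact h1.trans h2
  have hV : (T : ℝ) * (N : ℝ) ^ 2 * (V d - V d')
      = -2 * N * inner ℝ d (∑ n, (pplus n - p n)) - ‖∑ n, (pplus n - p n)‖ ^ 2 := by
    have e : (T : ℝ) * (N : ℝ) ^ 2 * (V d - V d') = (N : ℝ) ^ 2 * (T * V d - T * V d') := by ring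
    rw [e, V_aux hT, V_aux hT, hS, hdd, norm_add_sq_real, inner_smul_right, norm_smul, mul_pow,
      Real.norm_eq_abs, sq_abs]
    field_simp
    ring
  have main : (N : ℝ) * ∑ n, ‖pplus n - p n‖ ^ 2 ≤ (T : ℝ) * (N : ℝ) ^ 2 * (V d - V d') := by
    rw [hV]
    have := mul_le_mul_of_nonneg_left hsumopt hN'.le
    linarith
  refine ⟨main, ?_⟩
  have h0 : (0 : ℝ) ≤ (N : ℝ) * ∑ n, ‖pplus n - p n‖ ^ 2 := by positivity
  have := nonneg_of_mul_nonneg_right (h0.trans main) (by positivity)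
  linarith
end

section
/- Let T ≥ 1 and let N′, N″ be disjoint finite index sets with N := |N′| + |N″| ≥ 1. Let b ∈ ℝ^T, and for each n ∈ N′ ∪ N″ let p_n^∞, p_n^* ∈ ℝ^T have nonnegative entries and equal coordinate sums: Σ_{t=1}^T p_n^∞(t) = Σ_{t=1}^T p_n^*(t). Define d^∞ = (1/N)·(b + Σ_n p_n^∞) and d^* = (1/N)·(b + Σ_n p_n^*). Suppose the equilibrium variational inequalities hold: ⟨b + Σ_m p_m^∞, p_n^* − p_n^∞⟩ ≥ 0 for every n ∈ N′, and ⟨b + Σ_{m≠n} p_m^∞, p_n^* − p_n^∞⟩ ≥ 0 for every n ∈ N″. Then V(d^∞) − V(d^*) ≤ (2/(T·N²))·Σ_{n∈N″} ‖p_n^∞‖². -/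
open scoped RealInnerProductSpace

theorem V_eq_aux {T : ℕ} (hT : 1 ≤ T) (d : EuclideanSpace ℝ (Fin T)) :
    V d = (1 / (T : ℝ)) * ‖d‖ ^ 2 - ((1 / (T : ℝ)) * ∑ s, d s) ^ 2 := by
  have hT' : (T : ℝ) ≠ 0 := by positivity
  rw [EuclideanSpace.real_norm_sq_eq]
  generalize hm : (1 / (T : ℝ)) * ∑ s, d s = m
  have hs : ∑ s, d s = T * m := by rw [← hm]; field_simp
  have : ∑ t, (d t - m) ^ 2 = ∑ t, d t ^ 2 - 2 * m * ∑ t, d t + T * m ^ 2 := by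
    simp only [sub_sq, Finset.sum_add_distrib, Finset.sum_sub_distrib, Finset.mul_sum]
    simp only [Finset.sum_const, Finset.card_univ, Fintype.card_fin, nsmul_eq_mul]
    congr 2
    exact Finset.sum_congr rfl fun _ _ => by ring
  have hV : V d = (1 / (T : ℝ)) * ∑ t, (d t - m) ^ 2 := by
    rw [← hm]
    rfl
  rw [hV, this, hs]
  field_simp
  ring

theorem offline_gap_bound (T : ℕ) (hT : 1 ≤ T)
    {ι₁ ι₂ : Type*} [Fintype ι₁] [Fintype ι₂] [DecidableEq ι₂]
    (N : ℕ) (hNdef : N = Fintype.card ι₁ + Fintype.card ι₂) (hN : 1 ≤ N)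
    (b : EuclideanSpace ℝ (Fin T))
    (pinf₁ pstar₁ : ι₁ → EuclideanSpace ℝ (Fin T))
    (pinf₂ pstar₂ : ι₂ → EuclideanSpace ℝ (Fin T))
    (hpos₁ : ∀ n t, 0 ≤ pinf₁ n t) (hpos₁' : ∀ n t, 0 ≤ pstar₁ n t)
    (hpos₂ : ∀ n t, 0 ≤ pinf₂ n t) (hpos₂' : ∀ n t, 0 ≤ pstar₂ n t)
    (hsum₁ : ∀ n, ∑ t, pinf₁ n t = ∑ t, pstar₁ n t)
    (hsum₂ : ∀ n, ∑ t, pinf₂ n t = ∑ t, pstar₂ n t)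
    (dinf dstar : EuclideanSpace ℝ (Fin T))
    (hdinf : dinf = (1 / (N : ℝ)) • (b + (∑ n, pinf₁ n + ∑ n, pinf₂ n)))
    (hdstar : dstar = (1 / (N : ℝ)) • (b + (∑ n, pstar₁ n + ∑ n, pstar₂ n)))
    (hvi₁ : ∀ n, 0 ≤ ⟪b + (∑ m, pinf₁ m + ∑ m, pinf₂ m), pstar₁ n - pinf₁ n⟫)
    (hvi₂ : ∀ n : ι₂,
      0 ≤ ⟪b + (∑ m, pinf₁ m + ∑ m ∈ Finset.univ.erase n, pinf₂ m), pstar₂ n - pinf₂ n⟫) :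
    V dinf - V dstar ≤ (2 / ((T : ℝ) * (N : ℝ) ^ 2)) * ∑ n, ‖pinf₂ n‖ ^ 2 := by
  have hT' : (0 : ℝ) < T := by exact_mod_cast hT
  have hN' : (0 : ℝ) < N := by exact_mod_cast hN
  set S := b + (∑ n, pinf₁ n + ∑ n, pinf₂ n) with hS
  set S' := b + (∑ n, pstar₁ n + ∑ n, pstar₂ n) with hS'
  have hsumS : ∑ t, S t = ∑ t, S' t := by
    have e₁ : ∑ t, ∑ n, pinf₁ n t = ∑ t, ∑ n, pstar₁ n t := by
      rw [Finset.sum_comm, Finset.sum_congr rfl fun n _ => hsum₁ n, Finset.sum_comm]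
    have e₂ : ∑ t, ∑ n, pinf₂ n t = ∑ t, ∑ n, pstar₂ n t := by
      rw [Finset.sum_comm, Finset.sum_congr rfl fun n _ => hsum₂ n, Finset.sum_comm]
    simp [hS, hS', Finset.sum_add_distrib, e₁, e₂]
  have hsumd : ∑ t, dinf t = ∑ t, dstar t := by
    simp only [hdinf, hdstar, PiLp.smul_apply, smul_eq_mul, ← Finset.mul_sum, hsumS]
  have hn₁ : ‖dinf‖ ^ 2 = (1 / (N : ℝ)) ^ 2 * ‖S‖ ^ 2 := by
    rw [hdinf, norm_smul, mul_pow, Real.norm_eq_abs, sq_abs]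
  have hn₂ : ‖dstar‖ ^ 2 = (1 / (N : ℝ)) ^ 2 * ‖S'‖ ^ 2 := by
    rw [hdstar, norm_smul, mul_pow, Real.norm_eq_abs, sq_abs]
  have hdiff : S' - S = ∑ n, (pstar₁ n - pinf₁ n) + ∑ n, (pstar₂ n - pinf₂ n) := by
    rw [hS, hS', Finset.sum_sub_distrib, Finset.sum_sub_distrib]
    abel
  have h₂ : ∀ n, -‖pinf₂ n‖ ^ 2 ≤ ⟪S, pstar₂ n - pinf₂ n⟫ := by
    intro n
    have e : S = (b + (∑ m, pinf₁ m + ∑ m ∈ Finset.univ.erase n, pinf₂ m)) + pinf₂ n := by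
      rw [hS, ← Finset.sum_erase_add _ _ (Finset.mem_univ n)]
      abel
    have hp : 0 ≤ ⟪pinf₂ n, pstar₂ n⟫ := by
      rw [PiLp.inner_apply]
      refine Finset.sum_nonneg fun t _ => ?_
      simpa using mul_nonneg (hpos₂' n t) (hpos₂ n t)
    rw [e, inner_add_left, inner_sub_right (pinf₂ n), real_inner_self_eq_norm_sq]
    linarith [hvi₂ n]
  have hin : -∑ n, ‖pinf₂ n‖ ^ 2 ≤ ⟪S, S' - S⟫ := by
    rw [hdiff, inner_add_right, inner_sum, inner_sum, ← Finset.sum_neg_distrib]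
    have a := Finset.sum_nonneg fun n (_ : n ∈ Finset.univ) => hvi₁ n
    have c := Finset.sum_le_sum fun n (_ : n ∈ Finset.univ) => h₂ n
    linarith
  have hexp : ‖S'‖ ^ 2 = ‖S‖ ^ 2 + 2 * ⟪S, S' - S⟫ + ‖S' - S‖ ^ 2 := by
    rw [← norm_add_sq_real, add_sub_cancel]
  have hkey : ‖S‖ ^ 2 - ‖S'‖ ^ 2 ≤ 2 * ∑ n, ‖pinf₂ n‖ ^ 2 := by
    nlinarith [sq_nonneg ‖S' - S‖]
  rw [V_eq_aux hT, V_eq_aux hT, hsumd, hn₁, hn₂]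
  calc _ = (1 / ((T : ℝ) * (N : ℝ) ^ 2)) * (‖S‖ ^ 2 - ‖S'‖ ^ 2) := by
        field_simp
        ring
    _ ≤ (1 / ((T : ℝ) * (N : ℝ) ^ 2)) * (2 * ∑ n, ‖pinf₂ n‖ ^ 2) := by gcongr
    _ = _ := by ring
end
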